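/- Concentration lemma under subexponential concentration: Let Σ be a finite set with n elements, let w = (w_a)_{a∈Σ} be a random vector (not necessarily with independent components) satisfying subexponential concentration with constants C, c for bounded Lipschitz functions, and let σ be a random subset of Σ of size m chosen independently of w. Then for any 0 < α ≤ ∞, any probability measure ν on ℝ, any t > 0, and any f : ℝ → ℝ with |f|_{BL} ≤ 1, P_w[ |∫ f dμ_w − ∫ f dν| > E + t ] ≤ C·exp(−c·m^{1/α}t/L). -/

import Mathlib

open MeasureTheory ProbabilityTheory Real Filter
open scoped ENNReal

/-- The bounded-Lipschitz distance: supremum of `|∫ f dμ - ∫ f dν|` over functions with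
`|f|_{BL} ≤ 1`, i.e. `‖f‖_∞ ≤ 1` and `f` 1-Lipschitz. -/
noncomputable def blDist (μ ν : Measure ℝ) : ℝ :=
  ⨆ f : {f : ℝ → ℝ // (∀ x, |f x| ≤ 1) ∧ LipschitzWith 1 f},
    |(∫ x, f.1 x ∂μ) - ∫ x, f.1 x ∂ν|

/-- Each test function contributes at most `blDist` for probability measures. -/
lemma abs_integral_sub_le_blDist (μ ν : Measure ℝ) [IsProbabilityMeasure μ]
    [IsProbabilityMeasure ν] {f : ℝ → ℝ} (hfb : ∀ x, |f x| ≤ 1) (hfl : LipschitzWith 1 f) :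
    |(∫ x, f x ∂μ) - ∫ x, f x ∂ν| ≤ blDist μ ν := by
  have hbound : ∀ (ρ : Measure ℝ) [IsProbabilityMeasure ρ] (g : ℝ → ℝ), (∀ x, |g x| ≤ 1) →
      |∫ x, g x ∂ρ| ≤ 1 := by
    intro ρ _ g hg
    simpa using norm_integral_le_of_norm_le_const (μ := ρ) (f := g) (C := 1) (ae_of_all _ hg)
  refine le_ciSup (f := fun f : {f : ℝ → ℝ // (∀ x, |f x| ≤ 1) ∧ LipschitzWith 1 f} =>
    |(∫ x, f.1 x ∂μ) - ∫ x, f.1 x ∂ν|) ⟨2, ?_⟩ ⟨f, hfb, hfl⟩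
  rintro _ ⟨g, rfl⟩
  calc |(∫ x, g.1 x ∂μ) - ∫ x, g.1 x ∂ν| ≤ |∫ x, g.1 x ∂μ| + |∫ x, g.1 x ∂ν| := abs_sub _ _
    _ ≤ 2 := by linarith [hbound μ g.1 g.2.1, hbound ν g.1 g.2.1]

section QuenchedAverage

variable {ι : Type*} [Fintype ι]

lemma abs_quenchedAverage_le {q : Finset ι → ℝ} (hq0 : ∀ σ, 0 ≤ q σ) (hq1 : ∑ σ, q σ = 1)
    {g : Finset ι → ℝ} {B : ℝ} (hg : ∀ σ, q σ ≠ 0 → |g σ| ≤ B) : |∑ σ, q σ * g σ| ≤ B := by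
  calc |∑ σ, q σ * g σ| ≤ ∑ σ, |q σ * g σ| := Finset.abs_sum_le_sum_abs _ _
    _ ≤ ∑ σ, q σ * B := by
        refine Finset.sum_le_sum fun σ _ => ?_
        rw [abs_mul, abs_of_nonneg (hq0 σ)]
        rcases eq_or_ne (q σ) 0 with h | h
        · simp [h]
        · exact mul_le_mul_of_nonneg_left (hg σ h) (hq0 σ)
    _ = B := by rw [← Finset.sum_mul, hq1, one_mul]

variable [DecidableEq ι]

/-- The average over `σ`, with weights `q`, of `∑ a ∈ σ, d a` in terms of the inclusion
probabilities. -/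
lemma sum_mul_sum_mem_eq (q : Finset ι → ℝ) (d : ι → ℝ) :
    ∑ σ, q σ * ∑ a ∈ σ, d a
      = ∑ a, (∑ σ ∈ Finset.univ.filter (fun σ => a ∈ σ), q σ) * d a := by
  simp_rw [Finset.sum_mul, Finset.mul_sum, Finset.sum_filter]
  rw [Finset.sum_comm]
  refine Finset.sum_congr rfl fun σ _ => ?_
  rw [← Finset.sum_filter]
  simp

/-- The quenched integral of a 1-Lipschitz function is Lipschitz in the weights, with constant
the scaling times the `ℓ²` norm of the inclusion probabilities. -/
lemma abs_quenchedAverage_sub_le {q : Finset ι → ℝ} (hq0 : ∀ σ, 0 ≤ q σ) {K : ℝ} (hK : 0 ≤ K)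
    {f : ℝ → ℝ} (hfl : LipschitzWith 1 f) (x y : EuclideanSpace ℝ ι) :
    |(∑ σ, q σ * f (K * ∑ a ∈ σ, x a)) - ∑ σ, q σ * f (K * ∑ a ∈ σ, y a)|
      ≤ K * √(∑ a, (∑ σ ∈ Finset.univ.filter (fun σ => a ∈ σ), q σ) ^ 2) * dist x y := by
  have hf : ∀ u v, |f u - f v| ≤ |u - v| := fun u v => by
    simpa [Real.dist_eq] using hfl.dist_le_mul u v
  calc |(∑ σ, q σ * f (K * ∑ a ∈ σ, x a)) - ∑ σ, q σ * f (K * ∑ a ∈ σ, y a)|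
      = |∑ σ, q σ * (f (K * ∑ a ∈ σ, x a) - f (K * ∑ a ∈ σ, y a))| := by
        simp_rw [mul_sub, Finset.sum_sub_distrib]
    _ ≤ ∑ σ, |q σ * (f (K * ∑ a ∈ σ, x a) - f (K * ∑ a ∈ σ, y a))| :=
        Finset.abs_sum_le_sum_abs _ _
    _ ≤ ∑ σ, K * (q σ * ∑ a ∈ σ, |x a - y a|) := by
        refine Finset.sum_le_sum fun σ _ => ?_
        rw [abs_mul, abs_of_nonneg (hq0 σ), mul_left_comm K]
        refine mul_le_mul_of_nonneg_left ((hf _ _).trans ?_) (hq0 σ)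
        rw [← mul_sub, ← Finset.sum_sub_distrib, abs_mul, abs_of_nonneg hK]
        exact mul_le_mul_of_nonneg_left (Finset.abs_sum_le_sum_abs _ _) hK
    _ = K * ∑ a, (∑ σ ∈ Finset.univ.filter (fun σ => a ∈ σ), q σ) * |x a - y a| := by
        rw [← Finset.mul_sum, sum_mul_sum_mem_eq q (fun a => |x a - y a|)]
    _ ≤ K * (√(∑ a, (∑ σ ∈ Finset.univ.filter (fun σ => a ∈ σ), q σ) ^ 2) * dist x y) := by
        refine mul_le_mul_of_nonneg_left ((Real.sum_mul_le_sqrt_mul_sqrt _ _ _).trans_eq ?_) hK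
        simp [EuclideanSpace.dist_eq, Real.dist_eq]
    _ = _ := (mul_assoc _ _ _).symm

/-- The inclusion probabilities of a random nonempty set do not all vanish. -/
lemma sqrt_sum_inclusion_sq_pos {q : Finset ι → ℝ} (hq1 : ∑ σ, q σ = 1) {m : ℕ} (hm : 0 < m)
    (hqcard : ∀ σ, q σ ≠ 0 → σ.card = m) :
    0 < √(∑ a, (∑ σ ∈ Finset.univ.filter (fun σ => a ∈ σ), q σ) ^ 2) := by
  refine Real.sqrt_pos.mpr ((Finset.sum_nonneg fun a _ => sq_nonneg _).lt_of_ne' fun h => ?_)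
  rw [Finset.sum_eq_zero_iff_of_nonneg fun a _ => sq_nonneg _] at h
  have hsum := sum_mul_sum_mem_eq q (fun _ => 1)
  rw [Finset.sum_eq_zero (s := Finset.univ) (f := fun a => _ * (1 : ℝ))
    fun a ha => by rw [pow_eq_zero_iff two_ne_zero |>.mp (h a ha), zero_mul]] at hsum
  have hcard : ∑ σ, q σ * ∑ _a ∈ σ, (1 : ℝ) = m := by
    calc ∑ σ, q σ * ∑ _a ∈ σ, (1 : ℝ) = ∑ σ, q σ * m := by
          refine Finset.sum_congr rfl fun σ _ => ?_
          rcases eq_or_ne (q σ) 0 with h0 | h0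
          · simp [h0]
          · simp [hqcard σ h0]
      _ = m := by rw [← Finset.sum_mul, hq1, one_mul]
  have : (0 : ℝ) < m := Nat.cast_pos.mpr hm
  linarith

end QuenchedAverage

/-- Concentration lemma under subexponential concentration (SEC) for bounded Lipschitz functions. -/
theorem stmt3
    (ι : Type) [Fintype ι] [DecidableEq ι] (n : ℕ) (hn : Fintype.card ι = n)
    (Ω : Type) [MeasurableSpace Ω] (P : Measure Ω) [IsProbabilityMeasure P]
    (w : Ω → EuclideanSpace ℝ ι) (hw : Measurable w)
    (C c : ℝ) (hC : 0 < C) (hc : 0 < c)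
    -- subgaussian concentration for bounded 1-Lipschitz functions of the weight vector
    (hSEC : ∀ F : EuclideanSpace ℝ ι → ℝ, (∃ B, ∀ x, |F x| ≤ B) → LipschitzWith 1 F →
      ∀ u : ℝ, 0 < u →
        P {ω | u < |F (w ω) - ∫ ω', F (w ω') ∂P|} ≤ ENNReal.ofReal (C * Real.exp (-c * u)))
    (m : ℕ) (hm : 0 < m)
    (q : Finset ι → ℝ) (hq0 : ∀ σ, 0 ≤ q σ) (hq1 : (∑ σ, q σ) = 1)
    (hqcard : ∀ σ, q σ ≠ 0 → σ.card = m)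
    (L : ℝ)
    (hL : L = Real.sqrt (∑ a, (∑ σ ∈ Finset.univ.filter (fun σ => a ∈ σ), q σ) ^ 2))
    (α : ℝ≥0∞) (hα : 0 < α)
    (ν : Measure ℝ) [IsProbabilityMeasure ν]
    (E : ℝ)
    (hE : E = ⨆ σ : {σ : Finset ι // q σ ≠ 0},
        blDist (Measure.map (fun ω => (m : ℝ) ^ (-α⁻¹.toReal) * ∑ a ∈ σ.1, w ω a) P) ν)
    (t : ℝ) (ht : 0 < t)
    (f : ℝ → ℝ) (hfb : ∀ x, |f x| ≤ 1) (hfl : LipschitzWith 1 f) :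
    P {ω | E + t <
          |(∑ σ, q σ * f ((m : ℝ) ^ (-α⁻¹.toReal) * ∑ a ∈ σ, w ω a)) - ∫ x, f x ∂ν|}
      ≤ ENNReal.ofReal
          (C * Real.exp (-c * (m : ℝ) ^ α⁻¹.toReal * t / L)) := by
  set K : ℝ := (m : ℝ) ^ (-α⁻¹.toReal) with hKdef
  have hmpos : (0 : ℝ) < m := Nat.cast_pos.mpr hm
  have hKpos : 0 < K := Real.rpow_pos_of_pos hmpos _
  have hLpos : 0 < L := hL ▸ sqrt_sum_inclusion_sq_pos hq1 hm hqcard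
  have hKL : 0 < K * L := mul_pos hKpos hLpos
  have hmeas : ∀ σ : Finset ι, Measurable fun ω => K * ∑ a ∈ σ, w ω a := fun σ => by fun_prop
  have hfm : Measurable f := hfl.continuous.measurable
  set G : EuclideanSpace ℝ ι → ℝ := fun x => ∑ σ, q σ * f (K * ∑ a ∈ σ, x a) with hG
  have hmean : |(∫ ω, G (w ω) ∂P) - ∫ x, f x ∂ν| ≤ E := by
    have hint : ∫ ω, G (w ω) ∂P
        = ∑ σ, q σ * ∫ x, f x ∂(P.map fun ω => K * ∑ a ∈ σ, w ω a) := by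
      rw [integral_finsetSum]
      · refine Finset.sum_congr rfl fun σ _ => ?_
        rw [integral_const_mul,
          integral_map (hmeas σ).aemeasurable hfm.aestronglyMeasurable]
      · exact fun σ _ => (Integrable.of_bound (hfm.comp (hmeas σ)).aestronglyMeasurable 1
          (ae_of_all _ fun ω => hfb _)).const_mul _
    have hdiff : (∫ ω, G (w ω) ∂P) - ∫ x, f x ∂ν
        = ∑ σ, q σ * ((∫ x, f x ∂(P.map fun ω => K * ∑ a ∈ σ, w ω a)) - ∫ x, f x ∂ν) := by
      simp_rw [mul_sub, Finset.sum_sub_distrib, ← Finset.sum_mul, hq1, one_mul, hint]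
    rw [hdiff]
    refine abs_quenchedAverage_le hq0 hq1 fun σ hσ => ?_
    have := Measure.isProbabilityMeasure_map (μ := P) (hmeas σ).aemeasurable
    refine (abs_integral_sub_le_blDist _ ν hfb hfl).trans ?_
    rw [hE]
    exact le_ciSup (f := fun σ : {σ : Finset ι // q σ ≠ 0} =>
      blDist (P.map fun ω => K * ∑ a ∈ σ.1, w ω a) ν) (Set.finite_range _).bddAbove ⟨σ, hσ⟩
  have hlip : LipschitzWith 1 fun x => G x / (K * L) := by
    refine LipschitzWith.of_dist_le_mul fun x y => ?_
    rw [Real.dist_eq, ← sub_div, abs_div, abs_of_pos hKL, NNReal.coe_one, one_mul,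
      div_le_iff₀' hKL, hL]
    exact abs_quenchedAverage_sub_le hq0 hKpos.le hfl x y
  have hbdd : ∃ B, ∀ x, |G x / (K * L)| ≤ B := by
    refine ⟨1 / (K * L), fun x => ?_⟩
    rw [abs_div, abs_of_pos hKL]
    exact div_le_div_of_nonneg_right (abs_quenchedAverage_le hq0 hq1 fun σ _ => hfb _) hKL.le
  have hexp : -c * (m : ℝ) ^ α⁻¹.toReal * t / L = -c * (t / (K * L)) := by
    rw [hKdef, Real.rpow_neg hmpos.le]
    have := (Real.rpow_pos_of_pos hmpos α⁻¹.toReal).ne'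
    field_simp
  rw [hexp]
  refine (measure_mono fun ω hω => ?_).trans (hSEC _ hbdd hlip _ (div_pos ht hKL))
  simp only [Set.mem_ofPred_eq] at hω ⊢
  rw [integral_div, ← sub_div, abs_div, abs_of_pos hKL]
  refine div_lt_div_of_pos_right ?_ hKL
  have := abs_sub_le (G (w ω)) (∫ ω, G (w ω) ∂P) (∫ x, f x ∂ν)
  linarith
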